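/- Let k ≥ 3, let t₁ ≥ 1 and t₂ ≥ 1 be integers with 2t₁ + t₂ + k = n, where n ≥ 4k. Then ρ(K(t₁, t₂)) < ρ(K(0, 2t₁ + t₂)). -/

import Mathlib

open SimpleGraph

/-- The `l`-edge-connectivity of a graph: the minimum number of edges whose removal
leaves a graph with at least `l` connected components, if the graph has at least `l`
vertices; otherwise the number of vertices. -/
noncomputable def edgeConnL {V : Type*} (l : ℕ) (G : SimpleGraph V) : ℕ :=
  if l ≤ Nat.card V then
    sInf {c : ℕ | ∃ F : Set (Sym2 V), F ⊆ G.edgeSet ∧ F.ncard = c ∧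
      l ≤ Nat.card (G.deleteEdges F).ConnectedComponent}
  else Nat.card V

/-- A graph is minimally `(k,l)`-edge-connected if it is connected, its
`l`-edge-connectivity is at least `k`, and deleting any edge drops the
`l`-edge-connectivity below `k`. -/
def IsMinimallyKLEdgeConnected {V : Type*} (k l : ℕ) (G : SimpleGraph V) : Prop :=
  G.Connected ∧ k ≤ edgeConnL l G ∧
    ∀ e ∈ G.edgeSet, edgeConnL l (G.deleteEdges {e}) < k

/-- The real adjacency matrix of a simple graph. -/
noncomputable def adjMat {V : Type*} (G : SimpleGraph V) : Matrix V V ℝ :=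
  letI := Classical.decRel G.Adj
  G.adjMatrix ℝ

/-- The spectral radius of a graph: the largest (real) eigenvalue of its adjacency matrix. -/
noncomputable def specRad {V : Type*} [Fintype V] [DecidableEq V]
    (G : SimpleGraph V) : ℝ :=
  sSup (spectrum ℝ (adjMat G))

abbrev K1V (k t₁ t₂ t₃ : ℕ) : Type :=
  Unit ⊕ ((Fin t₁ × Fin 2) ⊕ (Fin (if t₂ = 0 then 0 else t₂ + 1) ⊕
    (Fin (if t₃ = 0 then 0 else t₃ + 2) ⊕ Fin (k - 2))))

/-- `K_1(t₁, t₂, t₃)` (with `k - 2` pendant edges): the graph obtained from the disjoint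
union of the friendship graph with `t₁` triangles (apex `u₁`), the complete bipartite graph
`K_{2,t₂}` (with `u₂` a vertex of maximum degree, i.e. in the part of size two), the complete
bipartite graph `K_{2,t₃+1}` (with `u₃` a vertex of degree 2, i.e. in the part of size
`t₃ + 1`), and the star `K_{1,k-2}` (centre `u₄`), by identifying `u₁, u₂, u₃, u₄` into a
single vertex `u*`.  Here `Sum.inl _` is `u*`; `Fin t₁ × Fin 2` are the outer triangle
vertices; in the third summand index `0` is the second vertex `v` of the part of size two of
`K_{2,t₂}` and indices `1, …, t₂` form the part of size `t₂` (this part is empty when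
`t₂ = 0`); in the fourth summand indices `0, 1` are the two vertices `w₁', w₂'` of the part
of size two of `K_{2,t₃+1}` and indices `2, …, t₃ + 1` are the remaining vertices of the
part of size `t₃ + 1` besides `u*` (this part is empty when `t₃ = 0`); the last summand
consists of the `k - 2` pendant vertices. -/
def K1Graph (k t₁ t₂ t₃ : ℕ) : SimpleGraph (K1V k t₁ t₂ t₃) :=
  SimpleGraph.fromRel (fun a b =>
    match a, b with
    | Sum.inl _, Sum.inr (Sum.inl _) => True
    | Sum.inl _, Sum.inr (Sum.inr (Sum.inl j)) => 1 ≤ j.val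
    | Sum.inl _, Sum.inr (Sum.inr (Sum.inr (Sum.inl j))) => j.val < 2
    | Sum.inl _, Sum.inr (Sum.inr (Sum.inr (Sum.inr _))) => True
    | Sum.inr (Sum.inl (i, _)), Sum.inr (Sum.inl (j, _)) => i = j
    | Sum.inr (Sum.inr (Sum.inl j)), Sum.inr (Sum.inr (Sum.inl j')) => j.val = 0 ∧ 1 ≤ j'.val
    | Sum.inr (Sum.inr (Sum.inr (Sum.inl j))), Sum.inr (Sum.inr (Sum.inr (Sum.inl j'))) =>
        j.val < 2 ∧ 2 ≤ j'.val
    | _, _ => False)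

/-- `K(t₁, t₂)` (with `k - 2` pendant edges): the graph obtained from the disjoint union of
the friendship graph with `t₁` triangles, the complete bipartite graph `K_{2,t₂}` and the
star `K_{1,k-2}` by identifying the apex, a maximum degree vertex of `K_{2,t₂}` and the
centre of the star into a single vertex; this is `K_1(t₁, t₂, 0)`. -/
def KGraph (k t₁ t₂ : ℕ) : SimpleGraph (K1V k t₁ t₂ 0) := K1Graph k t₁ t₂ 0

lemma adjMat_mulVec_apply {V : Type*} [Fintype V] (G : SimpleGraph V) [DecidableRel G.Adj]
    (z : V → ℝ) (v : V) :
    (adjMat G).mulVec z v = ∑ w, if G.Adj v w then z w else 0 := by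
  simp only [adjMat, Matrix.mulVec, dotProduct, SimpleGraph.adjMatrix_apply, ite_mul, one_mul,
    zero_mul]

lemma mem_spectrum_adjMat_iff {V : Type*} [Fintype V] [DecidableEq V] (G : SimpleGraph V)
    (μ : ℝ) : μ ∈ spectrum ℝ (adjMat G) ↔ ∃ z, z ≠ 0 ∧ (adjMat G).mulVec z = μ • z := by
  rw [← Matrix.spectrum_toLin', ← Module.End.hasEigenvalue_iff_mem_spectrum]
  constructor
  · intro h
    obtain ⟨z, hz⟩ := h.exists_hasEigenvector
    exact ⟨z, hz.2, by simpa using hz.apply_eq_smul⟩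
  · rintro ⟨z, hz, h⟩
    exact Module.End.hasEigenvalue_of_hasEigenvector
      (Module.End.hasEigenvector_iff.2 ⟨by simpa [Module.End.mem_eigenspace_iff] using h, hz⟩)

lemma finite_spectrum_adjMat {V : Type*} [Fintype V] [DecidableEq V] (G : SimpleGraph V) :
    (spectrum ℝ (adjMat G)).Finite := by
  rw [← Matrix.spectrum_toLin']
  exact Module.End.finite_spectrum _

lemma Fin.sum_univ_eq_of_eq_succ {N t : ℕ} (h : t + 1 = N) (f : Fin N → ℝ) :
    ∑ i, f i = f ⟨0, by omega⟩ + ∑ i : Fin t, f ⟨i + 1, by omega⟩ := by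
  subst h
  rw [Fin.sum_univ_succ]
  rfl

namespace KGraph

variable {k t₁ t₂ : ℕ}

/-- The vertex of `K(t₁, t₂)` obtained by identifying the three centres. -/
def hub (k t₁ t₂ : ℕ) : K1V k t₁ t₂ 0 := Sum.inl ()

/-- The outer triangle vertices of `K(t₁, t₂)`. -/
def tri (k t₂ : ℕ) (i : Fin t₁) (e : Fin 2) : K1V k t₁ t₂ 0 := Sum.inr (Sum.inl (i, e))

/-- The vertex of `K(t₁, t₂)` on the same side of `K_{2,t₂}` as the hub. -/
def twin (k t₁ : ℕ) (h : t₂ ≠ 0) : K1V k t₁ t₂ 0 :=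
  Sum.inr (Sum.inr (Sum.inl ⟨0, by simp [h]⟩))

/-- The common neighbours of the hub and its twin. -/
def mid (k t₁ : ℕ) (h : t₂ ≠ 0) (j : Fin t₂) : K1V k t₁ t₂ 0 :=
  Sum.inr (Sum.inr (Sum.inl ⟨j + 1, by simp [h]⟩))

/-- The pendant vertices of `K(t₁, t₂)`. -/
def leaf (t₁ t₂ : ℕ) (l : Fin (k - 2)) : K1V k t₁ t₂ 0 := Sum.inr (Sum.inr (Sum.inr (Sum.inr l)))

lemma sum_vertices (h : t₂ ≠ 0) (f : K1V k t₁ t₂ 0 → ℝ) :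
    ∑ w, f w = f (hub k t₁ t₂) + ((∑ i, (f (tri k t₂ i 0) + f (tri k t₂ i 1))) +
      (f (twin k t₁ h) + ∑ j, f (mid k t₁ h j) + ∑ l, f (leaf t₁ t₂ l))) := by
  have hz : ∀ g : Fin (if 0 = 0 then 0 else 0 + 2) → ℝ, ∑ i, g i = 0 := fun g => by
    exact Finset.sum_eq_zero fun i _ => i.elim0
  simp only [Fintype.sum_sum_type, Fintype.sum_prod_type, Fin.sum_univ_two, hz, zero_add,
    Fin.sum_univ_eq_of_eq_succ (show t₂ + 1 = if t₂ = 0 then 0 else t₂ + 1 by simp [h])]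
  simp [hub, tri, twin, mid, leaf]

lemma forall_vertices (h : t₂ ≠ 0) {P : K1V k t₁ t₂ 0 → Prop} (hub' : P (hub k t₁ t₂))
    (tri' : ∀ i e, P (tri k t₂ i e)) (twin' : P (twin k t₁ h))
    (mid' : ∀ j, P (mid k t₁ h j)) (leaf' : ∀ l, P (leaf t₁ t₂ l)) (w) : P w := by
  rcases w with _ | ⟨i, e⟩ | ⟨j, hj⟩ | j | l
  · exact hub'
  · exact tri' i e
  · rcases j with _ | j
    · exact twin'
    · exact mid' ⟨j, by simpa [h] using hj⟩
  · exact j.elim0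
  · exact leaf' l

section mulVec

variable (z : K1V k t₁ t₂ 0 → ℝ)

lemma mulVec_hub (h : t₂ ≠ 0) : (adjMat (KGraph k t₁ t₂)).mulVec z (hub k t₁ t₂) =
    ∑ i, (z (tri k t₂ i 0) + z (tri k t₂ i 1)) + ∑ j, z (mid k t₁ h j) +
      ∑ l, z (leaf t₁ t₂ l) := by
  classical
  rw [adjMat_mulVec_apply, sum_vertices h]
  simp [KGraph, K1Graph, hub, tri, twin, mid, leaf, add_assoc]

lemma mulVec_tri_zero (h : t₂ ≠ 0) (i : Fin t₁) :
    (adjMat (KGraph k t₁ t₂)).mulVec z (tri k t₂ i 0) =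
      z (hub k t₁ t₂) + z (tri k t₂ i 1) := by
  classical
  rw [adjMat_mulVec_apply, sum_vertices h]
  have hc (x : Fin t₁) : x = i ↔ i = x := eq_comm
  simp [KGraph, K1Graph, hub, tri, twin, mid, leaf, hc]

lemma mulVec_tri_one (h : t₂ ≠ 0) (i : Fin t₁) :
    (adjMat (KGraph k t₁ t₂)).mulVec z (tri k t₂ i 1) =
      z (hub k t₁ t₂) + z (tri k t₂ i 0) := by
  classical
  rw [adjMat_mulVec_apply, sum_vertices h]
  have hc (x : Fin t₁) : x = i ↔ i = x := eq_comm
  simp [KGraph, K1Graph, hub, tri, twin, mid, leaf, hc]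

lemma mulVec_twin (h : t₂ ≠ 0) : (adjMat (KGraph k t₁ t₂)).mulVec z (twin k t₁ h) =
    ∑ j, z (mid k t₁ h j) := by
  classical
  rw [adjMat_mulVec_apply, sum_vertices h]
  simp [KGraph, K1Graph, hub, tri, twin, mid, leaf]

lemma mulVec_mid (h : t₂ ≠ 0) (j : Fin t₂) :
    (adjMat (KGraph k t₁ t₂)).mulVec z (mid k t₁ h j) =
      z (hub k t₁ t₂) + z (twin k t₁ h) := by
  classical
  rw [adjMat_mulVec_apply, sum_vertices h]
  simp [KGraph, K1Graph, hub, tri, twin, mid, leaf]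

lemma mulVec_leaf (h : t₂ ≠ 0) (l : Fin (k - 2)) :
    (adjMat (KGraph k t₁ t₂)).mulVec z (leaf t₁ t₂ l) = z (hub k t₁ t₂) := by
  classical
  rw [adjMat_mulVec_apply, sum_vertices h]
  simp [KGraph, K1Graph, hub, tri, twin, mid, leaf]

end mulVec

/-- The secular equation satisfied by every large eigenvalue of `K(t₁, t₂)`. -/
lemma sq_eq_of_mem_spectrum (h : t₂ ≠ 0) {μ : ℝ} (hμ : 1 < μ) (hμt : (t₂ : ℝ) < μ ^ 2)
    (hs : μ ∈ spectrum ℝ (adjMat (KGraph k t₁ t₂))) :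
    μ ^ 2 = 2 * t₁ * (μ / (μ - 1)) + t₂ * (μ ^ 2 / (μ ^ 2 - t₂)) + (k - 2 : ℕ) := by
  obtain ⟨z, hz, hA⟩ := (mem_spectrum_adjMat_iff _ _).1 hs
  have hμ0 : μ ≠ 0 := by linarith
  have hμ1 : μ - 1 ≠ 0 := by linarith
  have hμ2 : μ ^ 2 - t₂ ≠ 0 := by linarith
  have key (w) := congrFun hA w
  simp only [Pi.smul_apply, smul_eq_mul] at key
  set a := z (hub k t₁ t₂) with ha
  have htri0 : ∀ i, z (tri k t₂ i 0) = a / (μ - 1) := fun i => by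
    have h0 := key (tri k t₂ i 0)
    have h1 := key (tri k t₂ i 1)
    rw [mulVec_tri_zero z h] at h0
    rw [mulVec_tri_one z h] at h1
    have : (μ + 1) * (z (tri k t₂ i 0) - z (tri k t₂ i 1)) = 0 := by linarith
    have : z (tri k t₂ i 0) - z (tri k t₂ i 1) = 0 :=
      (mul_eq_zero.1 this).resolve_left (by linarith)
    rw [eq_div_iff hμ1]
    linarith
  have htri1 : ∀ i, z (tri k t₂ i 1) = a / (μ - 1) := fun i => by
    have h0 := key (tri k t₂ i 0)
    rw [mulVec_tri_zero z h, htri0, ← ha] at h0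
    rw [eq_div_iff hμ1]
    field_simp at h0
    linarith
  have hmid : ∀ j, z (mid k t₁ h j) = (a + z (twin k t₁ h)) / μ := fun j => by
    have := key (mid k t₁ h j)
    rw [mulVec_mid z h] at this
    rw [eq_div_iff hμ0]
    linarith
  have hleaf : ∀ l, z (leaf t₁ t₂ l) = a / μ := fun l => by
    have := key (leaf t₁ t₂ l)
    rw [mulVec_leaf z h] at this
    rw [eq_div_iff hμ0]
    linarith
  have htwin : z (twin k t₁ h) = t₂ * a / (μ ^ 2 - t₂) := by
    have := key (twin k t₁ h)
    rw [mulVec_twin z h] at this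
    simp only [hmid, Finset.sum_const, Finset.card_univ, Fintype.card_fin, nsmul_eq_mul] at this
    rw [eq_div_iff hμ2]
    field_simp at this
    linarith
  have ha0 : a ≠ 0 := by
    intro ha0
    rw [ha0] at htri0 htri1 hmid hleaf htwin
    refine hz (funext (forall_vertices h ?_ ?_ ?_ ?_ ?_))
    · simpa [← ha] using ha0
    · intro i e
      fin_cases e <;> simp [htri0, htri1]
    · simp [htwin]
    · simp [hmid, htwin]
    · simp [hleaf]
  have hhub := key (hub k t₁ t₂)
  rw [mulVec_hub z h] at hhub
  simp only [htri0, htri1, hmid, hleaf, htwin, Finset.sum_const, Finset.card_univ,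
    Fintype.card_fin, nsmul_eq_mul, ← ha] at hhub
  apply mul_left_cancel₀ ha0
  field_simp at hhub ⊢
  linear_combination -hhub

/-- The root of the characteristic quadratic of `K(0, m)` is the square of an eigenvalue. -/
lemma mem_spectrum_of_sq {m : ℕ} (h : m ≠ 0) {R : ℝ} (hR : R ≠ 0)
    (hq : (R ^ 2 - (k - 2 : ℕ)) * (R ^ 2 - m) = m * R ^ 2) :
    R ∈ spectrum ℝ (adjMat (KGraph k 0 m)) := by
  let z : K1V k 0 m 0 → ℝ
    | Sum.inl _ => R ^ 2 - m
    | Sum.inr (Sum.inl _) => 0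
    | Sum.inr (Sum.inr (Sum.inl j)) => if j.val = 0 then (m : ℝ) else R
    | Sum.inr (Sum.inr (Sum.inr (Sum.inl _))) => 0
    | Sum.inr (Sum.inr (Sum.inr (Sum.inr _))) => (R ^ 2 - m) / R
  have hhub : z (hub k 0 m) = R ^ 2 - m := rfl
  have htwin : z (twin k 0 h) = m := rfl
  have hmid : ∀ j, z (mid k 0 h j) = R := fun j => if_neg (Nat.succ_ne_zero j)
  have hleaf : ∀ l, z (leaf 0 m l) = (R ^ 2 - m) / R := fun l => rfl
  refine (mem_spectrum_adjMat_iff _ _).2 ⟨z, fun hz => h ?_,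
    funext (forall_vertices h ?_ ?_ ?_ ?_ ?_)⟩
  · have := congrFun hz (twin k 0 h)
    rw [htwin, Pi.zero_apply] at this
    exact_mod_cast this
  · rw [mulVec_hub z h]
    simp only [hhub, hmid, hleaf, Finset.univ_eq_empty, Finset.sum_empty, Finset.sum_const,
      Finset.card_univ, Fintype.card_fin, nsmul_eq_mul, Pi.smul_apply, smul_eq_mul]
    field_simp
    linear_combination -hq
  · exact fun i => i.elim0
  · rw [mulVec_twin z h]
    simp [htwin, hmid, mul_comm]
  · intro j
    rw [mulVec_mid z h]
    simp only [hhub, htwin, hmid, Pi.smul_apply, smul_eq_mul]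
    ring
  · intro l
    rw [mulVec_leaf z h]
    simp only [hhub, hleaf, Pi.smul_apply, smul_eq_mul]
    field_simp

end KGraph

/-- The secular function of `K(t₁, t₂)` is negative beyond the spectral radius `R`
of `K(0, m)`, where `m = 2 t₁ + t₂`. -/
lemma secular_lt_sq {m t p R μ : ℝ} (hp : 0 ≤ p) (hm : 3 * p + 6 ≤ m) (ht : 0 < t) (htm : t < m)
    (hR : 0 < R) (hRm : 2 * m ≤ R ^ 2) (hRp : R ^ 2 ≤ 2 * m + p)
    (hq : (R ^ 2 - p) * (R ^ 2 - m) = m * R ^ 2) (hμ : R ≤ μ) :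
    (m - t) * (μ / (μ - 1)) + t * (μ ^ 2 / (μ ^ 2 - t)) + p < μ ^ 2 := by
  have hR1 : 1 < R := by nlinarith
  have hRm' : R < m := by nlinarith
  have hsq : R ^ 2 ≤ μ ^ 2 := by gcongr
  have h1 : μ / (μ - 1) ≤ R / (R - 1) := by
    rw [div_le_div_iff₀ (by linarith) (by linarith)]
    nlinarith
  have h2 : μ ^ 2 / (μ ^ 2 - t) ≤ R ^ 2 / (R ^ 2 - t) := by
    rw [div_le_div_iff₀ (by linarith) (by linarith)]
    nlinarith
  have h3 : R ^ 2 - p = m * R ^ 2 / (R ^ 2 - m) := by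
    rw [eq_div_iff (by linarith)]
    exact hq
  have h4 : R ^ 2 < R * m + t * ((R ^ 2 - m) / R) := by
    have : 0 < t * ((R ^ 2 - m) / R) := mul_pos ht (div_pos (by linarith) hR)
    nlinarith
  have h5 : (m - t) * (R / (R - 1)) + t * (R ^ 2 / (R ^ 2 - t)) < m * R ^ 2 / (R ^ 2 - m) := by
    have hx1 : 0 < R - 1 := by linarith
    have hx2 : 0 < R ^ 2 - t := by linarith
    have hx3 : 0 < R ^ 2 - m := by linarith
    have h6 : (R ^ 2) ^ 2 < R * (R ^ 2 * m + t * (R ^ 2 - m)) := by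
      field_simp at h4
      nlinarith [mul_pos hR hR]
    have h7 : m * R ^ 2 / (R ^ 2 - m) - ((m - t) * (R / (R - 1)) + t * (R ^ 2 / (R ^ 2 - t))) =
        (m - t) * (R * (R ^ 2 * m + t * (R ^ 2 - m)) - (R ^ 2) ^ 2) /
          ((R - 1) * (R ^ 2 - t) * (R ^ 2 - m)) := by
      field_simp
      ring
    have : 0 < (m - t) * (R * (R ^ 2 * m + t * (R ^ 2 - m)) - (R ^ 2) ^ 2) /
          ((R - 1) * (R ^ 2 - t) * (R ^ 2 - m)) :=
      div_pos (mul_pos (by linarith) (by linarith)) (by positivity)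
    linarith
  calc (m - t) * (μ / (μ - 1)) + t * (μ ^ 2 / (μ ^ 2 - t)) + p
      ≤ (m - t) * (R / (R - 1)) + t * (R ^ 2 / (R ^ 2 - t)) + p := by
        have : 0 ≤ m - t := by linarith
        gcongr
    _ < R ^ 2 := by linarith
    _ ≤ μ ^ 2 := hsq

/-- Let `k ≥ 3`, and let `t₁ ≥ 1`, `t₂ ≥ 1` be integers with `2t₁ + t₂ + k = n`,
where `n ≥ 4k`.  Then `ρ(K(t₁, t₂)) < ρ(K(0, 2t₁ + t₂))`. -/
theorem spectral_radius_K_lt (k n t₁ t₂ : ℕ) (hk : 3 ≤ k)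
    (ht₁ : 1 ≤ t₁) (ht₂ : 1 ≤ t₂) (hsum : 2 * t₁ + t₂ + k = n) (hn : 4 * k ≤ n) :
    specRad (KGraph k t₁ t₂) < specRad (KGraph k 0 (2 * t₁ + t₂)) := by
  obtain ⟨p, hp⟩ : ∃ p : ℝ, p = (k - 2 : ℕ) := ⟨_, rfl⟩
  obtain ⟨m, hm⟩ : ∃ m : ℝ, m = (2 * t₁ + t₂ : ℕ) := ⟨_, rfl⟩
  have hp0 : 0 ≤ p := hp ▸ Nat.cast_nonneg _
  have hpm : 3 * p + 6 ≤ m := by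
    rw [hp, hm]
    exact_mod_cast (by omega : 3 * (k - 2) + 6 ≤ 2 * t₁ + t₂)
  have ht0 : (0 : ℝ) < t₂ := by exact_mod_cast ht₂
  have htm : (t₂ : ℝ) < m := by
    rw [hm]
    exact_mod_cast (by omega : t₂ < 2 * t₁ + t₂)
  have hD1 : 2 * m ≤ √(4 * m ^ 2 + p ^ 2) := Real.le_sqrt_of_sq_le (by nlinarith)
  have hD2 : √(4 * m ^ 2 + p ^ 2) ≤ 2 * m + p := Real.sqrt_le_iff.2 ⟨by linarith, by nlinarith⟩
  have hD3 : √(4 * m ^ 2 + p ^ 2) ^ 2 = 4 * m ^ 2 + p ^ 2 := Real.sq_sqrt (by positivity)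
  obtain ⟨x, hx⟩ : ∃ x, x = (2 * m + p + √(4 * m ^ 2 + p ^ 2)) / 2 := ⟨_, rfl⟩
  have hx0 : 0 < x := by linarith
  have hR : 0 < √x := Real.sqrt_pos.2 hx0
  have hR2 : √x ^ 2 = x := Real.sq_sqrt hx0.le
  have hq : (√x ^ 2 - p) * (√x ^ 2 - m) = m * √x ^ 2 := by
    rw [hR2, hx]
    linear_combination hD3 / 4
  have hle : √x ≤ specRad (KGraph k 0 (2 * t₁ + t₂)) := by
    refine le_csSup (finite_spectrum_adjMat _).bddAbove
      (KGraph.mem_spectrum_of_sq (by omega) hR.ne' ?_)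
    rw [← hp, ← hm]
    exact hq
  refine lt_of_lt_of_le ?_ hle
  rcases (spectrum ℝ (adjMat (KGraph k t₁ t₂))).eq_empty_or_nonempty with he | hne
  · rw [specRad, he, Real.sSup_empty]
    exact hR
  · have hmem := hne.csSup_mem (finite_spectrum_adjMat _)
    change specRad _ ∈ _ at hmem
    by_contra! hge
    have hsq : x ≤ specRad (KGraph k t₁ t₂) ^ 2 := by
      rw [← hR2]
      gcongr
    have h1 : 1 < √x := Real.lt_sqrt_of_sq_lt (by linarith)
    have heq := KGraph.sq_eq_of_mem_spectrum (by omega) (h1.trans_le hge) (by linarith) hmem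
    have hlt := secular_lt_sq hp0 hpm ht0 htm hR (by linarith) (by linarith) hq hge
    have hmt : m - t₂ = 2 * t₁ := by
      rw [hm]
      push_cast
      ring
    rw [hmt, hp] at hlt
    linarith
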